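/- Let γ_0,…,γ_{r−1} be partitions with associated monomials u_{i,n}, v_{i,m}, and let 0 ≤ i, j ≤ r−1. Then [M(y^{−1} e_i e_j^{−1} t_1; t_1^{−1}, t_2) / M(e_i e_j^{−1} t_1; t_1^{−1}, t_2)] · ∏_{n,m>0} (1 − y^{−1} t_1 u_{j,n} v_{i,m}) / (1 − t_1 u_{j,n} v_{i,m}) = y^{−|γ_i| − |γ_j|} · [M(y e_j e_i^{−1} t_2^{−1}; t_1^{−1}, t_2) / M(e_j e_i^{−1} t_2^{−1}; t_1^{−1}, t_2)] · ∏_{n,m>0} (1 − y t_2^{−1} u_{i,n} v_{j,m}) / (1 − t_2^{−1} u_{i,n} v_{j,m}), as an identity of formal series. -/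

import Mathlib

/-!
STATEMENT 4.
The formal completion "in which `t₁⁻¹` and `t₂` have positive order" is realised as the
field of Hahn series `HahnSeries (ℤ ×ₗ ℤ) F` over a(n arbitrary) field `F`: the monomial
`t₁^a t₂^b` is the Hahn single supported at `(b − a, −a)` (total order first, then the
power of `t₁⁻¹`), so that `t₁⁻¹ ↦ (1,1) > 0` and `t₂ ↦ (1,0) > 0`.  The invertible
formal coefficient variables `y, e₀, …, e_{r−1}` are arbitrary nonzero elements of `F`.
All infinite products over `n, m > 0` converge coefficientwise; equality of the two
sides is expressed by saying that, below any given degree, the truncated products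
(over `1 ≤ n, m ≤ N`) of the two sides eventually agree.
-/

noncomputable section

abbrev Γ2 : Type := ℤ ×ₗ ℤ

variable (F : Type*) [Field F]

/-- The monomial `t₁^a t₂^b`. -/
def mono (a b : ℤ) : HahnSeries Γ2 F := HahnSeries.single (toLex (b - a, -a)) 1

/-- `u_{i,n} = e_i⁻¹ t₁^{(γ'_i)ₙ} t₂^n` (here `n : ℕ` encodes the 1-indexed `n+1`). -/
def uMon {r : ℕ} (Pa : Fin r → YoungDiagram) (e : Fin r → F) (i : Fin r) (n : ℕ) :
    HahnSeries Γ2 F :=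
  (HahnSeries.C (e i))⁻¹ * mono F ((Pa i).colLen n) (n + 1)

/-- `v_{i,m} = e_i t₁^{−m} t₂^{−(γ_i)ₘ}` (here `m : ℕ` encodes the 1-indexed `m+1`). -/
def vMon {r : ℕ} (Pa : Fin r → YoungDiagram) (e : Fin r → F) (i : Fin r) (m : ℕ) :
    HahnSeries Γ2 F :=
  HahnSeries.C (e i) * mono F (-(m + 1)) (-(Pa i).rowLen m)

/-- Truncation (over `1 ≤ n, m ≤ N`) of the generalised MacMahon function
`M(K; t₁⁻¹, t₂) = ∏_{n,m>0} (1 − K t₁^{−n} t₂^m)⁻¹`. -/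
def Mtr (K : HahnSeries Γ2 F) (N : ℕ) : HahnSeries Γ2 F :=
  ∏ n ∈ Finset.range N, ∏ m ∈ Finset.range N, (1 - K * mono F (-(n + 1)) (m + 1))⁻¹

/-- Laurent polynomials in two variables. -/
abbrev LP2 : Type := AddMonoidAlgebra ℤ (ℤ × ℤ)

/-- The Laurent monomial. -/
def XX (a b : ℤ) : LP2 := AddMonoidAlgebra.single (a, b) 1

lemma XX_mul (a b c d : ℤ) : XX a b * XX c d = XX (a + c) (b + d) := by
  simp [XX, AddMonoidAlgebra.single_mul_single]

lemma XX_zero : XX 0 0 = 1 := rfl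

/-- Sum over the cells. -/
def QQ (s : ℤ) (μ : YoungDiagram) : LP2 := ∑ c ∈ μ.cells, XX (s * c.1) (s * c.2)

lemma sum_cells_col (μ : YoungDiagram) (N : ℕ) (hμ : ∀ c ∈ μ.cells, c.1 < N ∧ c.2 < N)
    (f : ℕ → ℕ → LP2) :
    ∑ c ∈ μ.cells, f c.1 c.2 = ∑ n ∈ Finset.range N, ∑ a ∈ Finset.range (μ.colLen n), f a n := by
  rw [Finset.sum_sigma']
  refine Finset.sum_bij' (fun c _ => ⟨c.2, c.1⟩) (fun c _ => (c.2, c.1)) ?_ ?_ ?_ ?_ ?_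
  · intro c hc
    simp only [Finset.mem_sigma, Finset.mem_range]
    exact ⟨(hμ c hc).2, YoungDiagram.mem_iff_lt_colLen.1 (by simpa using hc)⟩
  · intro c hc
    simp only [Finset.mem_sigma, Finset.mem_range] at hc
    simpa using YoungDiagram.mem_iff_lt_colLen.2 hc.2
  all_goals simp

lemma sum_cells_row (μ : YoungDiagram) (N : ℕ) (hμ : ∀ c ∈ μ.cells, c.1 < N ∧ c.2 < N)
    (f : ℕ → ℕ → LP2) :
    ∑ c ∈ μ.cells, f c.1 c.2 = ∑ m ∈ Finset.range N, ∑ b ∈ Finset.range (μ.rowLen m), f m b := by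
  rw [Finset.sum_sigma']
  refine Finset.sum_bij' (fun c _ => ⟨c.1, c.2⟩) (fun c _ => (c.1, c.2)) ?_ ?_ ?_ ?_ ?_
  · intro c hc
    simp only [Finset.mem_sigma, Finset.mem_range]
    exact ⟨(hμ c hc).1, YoungDiagram.mem_iff_lt_rowLen.1 (by simpa using hc)⟩
  · intro c hc
    simp only [Finset.mem_sigma, Finset.mem_range] at hc
    simpa using YoungDiagram.mem_iff_lt_rowLen.2 hc.2
  all_goals simp

lemma geomXX (p q p0 q0 : ℤ) (k : ℕ) :
    (XX p q - 1) * ∑ a ∈ Finset.range k, XX (p0 + p * a) (q0 + q * a)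
      = XX (p0 + p * k) (q0 + q * k) - XX p0 q0 := by
  induction k with
  | zero => simp
  | succ k ih =>
    rw [Finset.sum_range_succ, mul_add, ih, sub_mul, XX_mul, one_mul]
    have h1 : p + (p0 + p * (k : ℤ)) = p0 + p * ((k + 1 : ℕ) : ℤ) := by push_cast; ring
    have h2 : q + (q0 + q * (k : ℤ)) = q0 + q * ((k + 1 : ℕ) : ℤ) := by push_cast; ring
    rw [h1, h2]; ring

lemma UU_eq (s : ℤ) (μ : YoungDiagram) (N : ℕ) (hμ : ∀ c ∈ μ.cells, c.1 < N ∧ c.2 < N) :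
    ∑ n ∈ Finset.range N, XX (s * μ.colLen n) (s * (n + 1))
      = ∑ n ∈ Finset.range N, XX 0 (s * (n + 1)) + (XX s 0 - 1) * XX 0 s * QQ s μ := by
  rw [QQ, sum_cells_col μ N hμ (fun a b => XX (s * a) (s * b)), mul_assoc, Finset.mul_sum,
    Finset.mul_sum, ← Finset.sum_add_distrib]
  refine Finset.sum_congr rfl fun n _ => ?_
  have := geomXX s 0 0 (s * (n + 1)) (μ.colLen n)
  rw [Finset.mul_sum]
  simp only [XX_mul]
  simp only [zero_add, zero_mul, add_zero] at this ⊢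
  rw [show (fun a : ℕ => XX (s * (a : ℤ)) (s + s * (n : ℤ))) = fun a : ℕ => XX (s * (a : ℤ)) (s * (n + 1)) by
    funext a; congr 1; ring]
  rw [this]; ring

lemma VV_eq (s : ℤ) (μ : YoungDiagram) (N : ℕ) (hμ : ∀ c ∈ μ.cells, c.1 < N ∧ c.2 < N) :
    ∑ m ∈ Finset.range N, XX (s * (m + 1)) (s * μ.rowLen m)
      = ∑ m ∈ Finset.range N, XX (s * (m + 1)) 0 + (XX 0 s - 1) * XX s 0 * QQ s μ := by
  rw [QQ, sum_cells_row μ N hμ (fun a b => XX (s * a) (s * b)), mul_assoc, Finset.mul_sum,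
    Finset.mul_sum, ← Finset.sum_add_distrib]
  refine Finset.sum_congr rfl fun n _ => ?_
  have := geomXX 0 s (s * (n + 1)) 0 (μ.rowLen n)
  rw [Finset.mul_sum]
  simp only [XX_mul]
  simp only [zero_add, zero_mul, add_zero] at this ⊢
  rw [show (fun a : ℕ => XX (s + s * (n : ℤ)) (s * (a : ℤ))) = fun a : ℕ => XX (s * (n + 1)) (s * (a : ℤ)) by
    funext a; congr 1; ring]
  rw [this]; ring

lemma ZZ_eq (s : ℤ) (N : ℕ) :
    (XX 0 (-s) - 1) * ∑ n ∈ Finset.range N, XX 0 (s * (n + 1)) = 1 - XX 0 (s * N) := by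
  have := geomXX 0 s 0 s N
  have h2 : XX 0 (-s) * XX 0 s = 1 := by rw [XX_mul]; simp [XX_zero]
  simp only [zero_add, zero_mul] at this
  rw [show (fun n : ℕ => XX 0 (s * ((n : ℤ) + 1))) = fun n : ℕ => XX 0 (s + s * n) by
    funext a; congr 1; ring]
  have h3 : XX 0 (s + s * N) = XX 0 s * XX 0 (s * N) := by rw [XX_mul]; simp
  rw [h3] at this
  linear_combination (-XX 0 (-s)) * this + (∑ n ∈ Finset.range N, XX 0 (s + s * n) - XX 0 (s * N) + 1) * h2

lemma YY_eq (s : ℤ) (N : ℕ) :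
    (XX (-s) 0 - 1) * ∑ n ∈ Finset.range N, XX (s * (n + 1)) 0 = 1 - XX (s * N) 0 := by
  have := geomXX s 0 s 0 N
  have h2 : XX (-s) 0 * XX s 0 = 1 := by rw [XX_mul]; simp [XX_zero]
  simp only [zero_add, zero_mul] at this
  rw [show (fun n : ℕ => XX (s * ((n : ℤ) + 1)) 0) = fun n : ℕ => XX (s + s * n) 0 by
    funext a; congr 1; ring]
  have h3 : XX (s + s * N) 0 = XX s 0 * XX (s * N) 0 := by rw [XX_mul]; simp
  rw [h3] at this
  linear_combination (-XX (-s) 0) * this + (∑ n ∈ Finset.range N, XX (s + s * n) 0 - XX (s * N) 0 + 1) * h2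

/-- The common finite character. -/
def TT (μ ν : YoungDiagram) : LP2 :=
  QQ (-1) ν + XX 1 0 * XX 0 1 * QQ 1 μ + (XX 1 0 - 1) * (1 - XX 0 1) * QQ 1 μ * QQ (-1) ν

lemma lemA (μ ν : YoungDiagram) (N : ℕ) (hμ : ∀ c ∈ μ.cells, c.1 < N ∧ c.2 < N)
    (hν : ∀ c ∈ ν.cells, c.1 < N ∧ c.2 < N) :
    ∑ n ∈ Finset.range N, ∑ m ∈ Finset.range N,
      XX (1 + μ.colLen n - (m + 1)) (n + 1 - ν.rowLen m)
    - ∑ n ∈ Finset.range N, ∑ m ∈ Finset.range N, XX (1 - (m + 1)) (n + 1)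
    = TT μ ν - (∑ c ∈ ν.cells, XX (-c.1) (N - c.2) + ∑ c ∈ μ.cells, XX (1 - N + c.1) (1 + c.2)) := by
  have hU := UU_eq 1 μ N hμ
  have hV := VV_eq (-1) ν N hν
  have hZ := ZZ_eq 1 N
  have hY := YY_eq (-1) N
  have e1 : ∑ n ∈ Finset.range N, ∑ m ∈ Finset.range N,
      XX (1 + μ.colLen n - (m + 1)) (n + 1 - ν.rowLen m) =
      XX 1 0 * ((∑ n ∈ Finset.range N, XX (1 * μ.colLen n) (1 * (n + 1))) *
        ∑ m ∈ Finset.range N, XX (-1 * (m + 1)) (-1 * ν.rowLen m)) := by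
    rw [Finset.sum_mul_sum, Finset.mul_sum]
    refine Finset.sum_congr rfl fun n _ => ?_
    rw [Finset.mul_sum]
    refine Finset.sum_congr rfl fun m _ => ?_
    rw [XX_mul, XX_mul]; congr 1 <;> ring
  have e2 : ∑ n ∈ Finset.range N, ∑ m ∈ Finset.range N, XX (1 - (m + 1)) (n + 1) =
      XX 1 0 * ((∑ n ∈ Finset.range N, XX 0 (1 * (n + 1))) *
        ∑ m ∈ Finset.range N, XX (-1 * (m + 1)) 0) := by
    rw [Finset.sum_mul_sum, Finset.mul_sum]
    refine Finset.sum_congr rfl fun n _ => ?_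
    rw [Finset.mul_sum]
    refine Finset.sum_congr rfl fun m _ => ?_
    rw [XX_mul, XX_mul]; congr 1 <;> ring
  have e3 : ∑ c ∈ ν.cells, XX (-c.1) (N - c.2) = XX 0 (1 * N) * QQ (-1) ν := by
    rw [QQ, Finset.mul_sum]
    refine Finset.sum_congr rfl fun n _ => ?_
    rw [XX_mul]; congr 1 <;> ring
  have e4 : ∑ c ∈ μ.cells, XX (1 - N + c.1) (1 + c.2) =
      XX (-1 * N) 0 * XX 1 0 * XX 0 1 * QQ 1 μ := by
    rw [QQ, Finset.mul_sum]
    refine Finset.sum_congr rfl fun n _ => ?_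
    rw [XX_mul, XX_mul, XX_mul]; congr 1 <;> ring
  have hx : XX 1 0 * XX (-1) 0 = 1 := by rw [XX_mul]; simp [XX_zero]
  have hz : XX 0 1 * XX 0 (-1) = 1 := by rw [XX_mul]; simp [XX_zero]
  rw [e1, e2, e3, e4, hU, hV, TT]
  rw [neg_neg] at hY
  generalize ∑ n ∈ Finset.range N, XX 0 (1 * ((n : ℤ) + 1)) = Z at *
  generalize ∑ n ∈ Finset.range N, XX (-1 * ((n : ℤ) + 1)) 0 = Y at *
  clear e1 e2 e3 e4 hU hV
  generalize QQ 1 μ = P at *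
  generalize QQ (-1) ν = Q at *
  generalize XX 1 0 = x at *
  generalize XX (-1) 0 = x' at *
  generalize XX 0 1 = z at *
  generalize XX 0 (-1) = z' at *
  linear_combination x * z * P * hY + Q * x * x' * hZ
    + (1 - XX 0 (1 * N)) * Q * hx + (x - 1) * z * P * (z' - 1) * Q * hx + (x - 1) * P * Q * hz

lemma lemB (μ ν : YoungDiagram) (N : ℕ) (hμ : ∀ c ∈ μ.cells, c.1 < N ∧ c.2 < N)
    (hν : ∀ c ∈ ν.cells, c.1 < N ∧ c.2 < N) :
    ∑ n ∈ Finset.range N, ∑ m ∈ Finset.range N,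
      XX (m + 1 - ν.colLen n) (μ.rowLen m - n)
    - ∑ n ∈ Finset.range N, ∑ m ∈ Finset.range N, XX (m + 1) (-n)
    = TT μ ν - (∑ c ∈ μ.cells, XX (1 + c.1) (1 + c.2 - N) + ∑ c ∈ ν.cells, XX (N - c.1) (-c.2)) := by
  have hU := UU_eq (-1) ν N hν
  have hV := VV_eq 1 μ N hμ
  have hZ := ZZ_eq (-1) N
  have hY := YY_eq 1 N
  have e1 : ∑ n ∈ Finset.range N, ∑ m ∈ Finset.range N,
      XX (m + 1 - ν.colLen n) (μ.rowLen m - n) =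
      XX 0 1 * ((∑ n ∈ Finset.range N, XX (-1 * ν.colLen n) (-1 * (n + 1))) *
        ∑ m ∈ Finset.range N, XX (1 * (m + 1)) (1 * μ.rowLen m)) := by
    rw [Finset.sum_mul_sum, Finset.mul_sum]
    refine Finset.sum_congr rfl fun n _ => ?_
    rw [Finset.mul_sum]
    refine Finset.sum_congr rfl fun m _ => ?_
    rw [XX_mul, XX_mul]; congr 1 <;> ring
  have e2 : ∑ n ∈ Finset.range N, ∑ m ∈ Finset.range N, XX (m + 1) (-n) =
      XX 0 1 * ((∑ n ∈ Finset.range N, XX 0 (-1 * (n + 1))) *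
        ∑ m ∈ Finset.range N, XX (1 * (m + 1)) 0) := by
    rw [Finset.sum_mul_sum, Finset.mul_sum]
    refine Finset.sum_congr rfl fun n _ => ?_
    rw [Finset.mul_sum]
    refine Finset.sum_congr rfl fun m _ => ?_
    rw [XX_mul, XX_mul]; congr 1 <;> ring
  have e3 : ∑ c ∈ ν.cells, XX (N - c.1) (-c.2) = XX (1 * N) 0 * QQ (-1) ν := by
    rw [QQ, Finset.mul_sum]
    refine Finset.sum_congr rfl fun n _ => ?_
    rw [XX_mul]; congr 1 <;> ring
  have e4 : ∑ c ∈ μ.cells, XX (1 + c.1) (1 + c.2 - N) =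
      XX 0 (-1 * N) * XX 1 0 * XX 0 1 * QQ 1 μ := by
    rw [QQ, Finset.mul_sum]
    refine Finset.sum_congr rfl fun n _ => ?_
    rw [XX_mul, XX_mul, XX_mul]; congr 1 <;> ring
  have hx : XX 1 0 * XX (-1) 0 = 1 := by rw [XX_mul]; simp [XX_zero]
  have hz : XX 0 1 * XX 0 (-1) = 1 := by rw [XX_mul]; simp [XX_zero]
  rw [e1, e2, e3, e4, hU, hV, TT]
  rw [neg_neg] at hZ
  generalize ∑ n ∈ Finset.range N, XX 0 (-1 * ((n : ℤ) + 1)) = Z at *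
  generalize ∑ n ∈ Finset.range N, XX (1 * ((n : ℤ) + 1)) 0 = Y at *
  clear e1 e2 e3 e4 hU hV
  generalize QQ 1 μ = P at *
  generalize QQ (-1) ν = Q at *
  generalize XX 1 0 = x at *
  generalize XX (-1) 0 = x' at *
  generalize XX 0 1 = z at *
  generalize XX 0 (-1) = z' at *
  linear_combination x * z * P * hZ + Q * z * z' * hY
    + (1 - XX (1 * N) 0) * Q * hz + (x' - 1) * x * P * (z - 1) * Q * hz + (z - 1) * P * Q * hx
section absField
variable {H : Type*} [Field H]

open Classical in
/-- Nonvanishing modification. -/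
def fu (f : ℤ × ℤ → H) (w : ℤ × ℤ) : Hˣ := if h : f w ≠ 0 then Units.mk0 (f w) h else 1

/-- The multiplicative functional on characters. -/
def Phi (f : ℤ × ℤ → H) : LP2 →+ Additive Hˣ :=
  (Finsupp.liftAddHom (fun w => zmultiplesHom (Additive Hˣ) (Additive.ofMul (fu f w)))).comp
    (AddMonoidAlgebra.coeffAddEquiv : LP2 ≃+ (ℤ × ℤ →₀ ℤ)).toAddMonoidHom

lemma Phi_XX (f : ℤ × ℤ → H) (w : ℤ × ℤ) : Phi f (XX w.1 w.2) = Additive.ofMul (fu f w) := by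
  simp [Phi, XX]

/-- The value. -/
def PV (f : ℤ × ℤ → H) (A : LP2) : H := ((Phi f A).toMul : Hˣ)

lemma PV_add (f : ℤ × ℤ → H) (A B : LP2) : PV f (A + B) = PV f A * PV f B := by
  simp [PV]
lemma PV_sub (f : ℤ × ℤ → H) (A B : LP2) : PV f (A - B) = PV f A / PV f B := by
  simp [PV]
lemma PV_ne (f : ℤ × ℤ → H) (A : LP2) : PV f A ≠ 0 := by
  simp [PV]
lemma PV_zero (f : ℤ × ℤ → H) : PV f 0 = 1 := by
  simp [PV]
lemma PV_XX (f : ℤ × ℤ → H) (w : ℤ × ℤ) : PV f (XX w.1 w.2) = fu f w := by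
  simp [PV, Phi_XX]

lemma coeff_XX (w : ℤ × ℤ) : (XX w.1 w.2).coeff 0 = if w = 0 then 1 else 0 := by
  simp [XX, Finsupp.single_apply]

/-- Correction at the origin. -/
def del (f : ℤ × ℤ → H) : H := f 0 / fu f 0

lemma prod_f {ι : Type*} (f : ℤ × ℤ → H) (hf : ∀ w, w ≠ 0 → f w ≠ 0) (S : Finset ι)
    (P : ι → ℤ × ℤ) :
    ∃ k : ℕ, (∑ s ∈ S, XX (P s).1 (P s).2).coeff 0 = k ∧
      ∏ s ∈ S, f (P s) = del f ^ k * PV f (∑ s ∈ S, XX (P s).1 (P s).2) := by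
  classical
  induction S using Finset.induction_on with
  | empty => exact ⟨0, by simp, by simp [PV_zero]⟩
  | insert a S ha ih =>
    obtain ⟨k, h1, h2⟩ := ih
    rw [Finset.sum_insert ha, Finset.prod_insert ha, PV_add, PV_XX, h2,
      AddMonoidAlgebra.coeff_add, Finsupp.add_apply, h1, coeff_XX]
    by_cases h0 : P a = 0
    · refine ⟨k + 1, by simp [h0, add_comm], ?_⟩
      have : f 0 = del f * fu f 0 := by simp [del]
      rw [h0, this, pow_succ]; ring
    · refine ⟨k, by simp [h0], ?_⟩
      have : f (P a) = fu f (P a) := by simp [fu, hf _ h0]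
      rw [← this]; ring

lemma prod_f' {ι : Type*} (f : ℤ × ℤ → H) (hf : ∀ w, w ≠ 0 → f w ≠ 0) (S : Finset ι)
    (P : ι → ℤ × ℤ) (hP : ∀ s ∈ S, P s ≠ 0) :
    (∑ s ∈ S, XX (P s).1 (P s).2).coeff 0 = 0 ∧
      ∏ s ∈ S, f (P s) = PV f (∑ s ∈ S, XX (P s).1 (P s).2) := by
  obtain ⟨k, h1, h2⟩ := prod_f f hf S P
  have : (∑ s ∈ S, XX (P s).1 (P s).2).coeff 0 = 0 := by
    rw [AddMonoidAlgebra.coeff_sum, Finsupp.finsetSum_apply]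
    refine Finset.sum_eq_zero fun s hs => ?_
    rw [coeff_XX, if_neg (hP s hs)]
  refine ⟨this, ?_⟩
  rw [this] at h1
  have hk : k = 0 := by exact_mod_cast h1.symm
  rw [h2, hk]; simp

lemma keyf {ι κ : Type*} (f : ℤ × ℤ → H) (hf : ∀ w, w ≠ 0 → f w ≠ 0) (S : Finset ι)
    (P Q : ι → ℤ × ℤ) (S1 S2 : Finset κ) (L1 L2 : κ → ℤ × ℤ) (T : LP2)
    (hQ : ∀ s ∈ S, Q s ≠ 0) (hL1 : ∀ s ∈ S1, L1 s ≠ 0) (hL2 : ∀ s ∈ S2, L2 s ≠ 0)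
    (h : ∑ s ∈ S, XX (P s).1 (P s).2 - ∑ s ∈ S, XX (Q s).1 (Q s).2 =
      T - (∑ s ∈ S1, XX (L1 s).1 (L1 s).2 + ∑ s ∈ S2, XX (L2 s).1 (L2 s).2)) :
    (∏ s ∈ S, f (P s)) / ∏ s ∈ S, f (Q s) =
      (del f ^ (T.coeff 0).toNat * PV f T) * ((∏ s ∈ S1, (f (L1 s))⁻¹) * ∏ s ∈ S2, (f (L2 s))⁻¹) := by
  obtain ⟨k, h1, h2⟩ := prod_f f hf S P
  obtain ⟨q1, q2⟩ := prod_f' f hf S Q hQ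
  obtain ⟨a1, a2⟩ := prod_f' f hf S1 L1 hL1
  obtain ⟨b1, b2⟩ := prod_f' f hf S2 L2 hL2
  have hc := congrArg (fun A : LP2 => A.coeff 0) h
  simp only [AddMonoidAlgebra.coeff_sub, AddMonoidAlgebra.coeff_add, Finsupp.sub_apply,
    Finsupp.add_apply] at hc
  rw [h1, q1, a1, b1] at hc
  have hk : (T.coeff 0).toNat = k := by omega
  have hv := congrArg (PV f) h
  rw [PV_sub, PV_sub, PV_add] at hv
  rw [hk, Finset.prod_inv_distrib, Finset.prod_inv_distrib, h2, q2, a2, b2, mul_div_assoc, hv,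
    div_eq_mul_inv, mul_inv]
  ring

end absField
section hahn
variable {F}

/-- Series whose support has first coordinate at least `k`. -/
def OO (k : ℤ) (f : HahnSeries Γ2 F) : Prop := ∀ g : Γ2, (ofLex g).1 < k → f.coeff g = 0

lemma OO.mul {k l : ℤ} {f g : HahnSeries Γ2 F} (hf : OO k f) (hg : OO l g) :
    OO (k + l) (f * g) := by
  intro a ha
  rw [HahnSeries.coeff_mul]
  refine Finset.sum_eq_zero fun ij hij => ?_
  have h := (Finset.mem_antidiagonal.1 hij).2.2
  have h' : (ofLex ij.1).1 + (ofLex ij.2).1 = (ofLex a).1 := by rw [← h]; rfl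
  by_cases h1 : (ofLex ij.1).1 < k
  · rw [hf _ h1, zero_mul]
  · rw [hg _ (by omega), mul_zero]

lemma OO.add {k : ℤ} {f g : HahnSeries Γ2 F} (hf : OO k f) (hg : OO k g) : OO k (f + g) := by
  intro a ha
  rw [HahnSeries.coeff_add, hf a ha, hg a ha, add_zero]

lemma OO.sub {k : ℤ} {f g : HahnSeries Γ2 F} (hf : OO k f) (hg : OO k g) : OO k (f - g) := by
  intro a ha
  rw [HahnSeries.coeff_sub, hf a ha, hg a ha, sub_zero]

lemma OO.le {k l : ℤ} {f : HahnSeries Γ2 F} (hf : OO k f) (h : l ≤ k) : OO l f :=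
  fun a ha => hf a (by omega)

lemma OO_single (a b : ℤ) (c : F) : OO a (HahnSeries.single (toLex (a, b)) c) := by
  intro g hg
  refine HahnSeries.coeff_single_of_ne ?_
  rintro rfl
  simp at hg

lemma OO_one : OO 0 (1 : HahnSeries Γ2 F) := OO_single 0 0 1

lemma OO_order (f : HahnSeries Γ2 F) : OO (ofLex f.order).1 f := by
  intro g hg
  exact HahnSeries.coeff_eq_zero_of_lt_order (Prod.Lex.lt_iff.2 (Or.inl hg))

lemma one_sub_ne {k : ℤ} (hk : 0 < k) {w : HahnSeries Γ2 F} (hw : OO k w) : 1 - w ≠ 0 := by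
  intro h
  have h1 : w = 1 := (sub_eq_zero.1 h).symm
  have := hw 0 hk
  rw [h1] at this
  simp at this

lemma OO_inv {k : ℤ} (hk : 0 < k) {w : HahnSeries Γ2 F} (hw : OO k w) : OO 0 (1 - w)⁻¹ := by
  have hne := one_sub_ne hk hw
  set f := (1 - w)⁻¹ with hf
  have hf0 : f ≠ 0 := inv_ne_zero hne
  have h1 : f = 1 + f * w := by
    have : f * (1 - w) = 1 := inv_mul_cancel₀ hne
    linear_combination this
  refine (OO_order f).le ?_
  by_contra! hlt
  have h2 := OO_one (F := F) _ hlt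
  have h3 := (OO_order f).mul hw f.order (by omega)
  have h4 : f.coeff f.order = 0 :=
    calc f.coeff f.order = (1 + f * w).coeff f.order :=
          congrArg (fun h : HahnSeries Γ2 F => h.coeff f.order) h1
      _ = 0 := by rw [HahnSeries.coeff_add, h2, h3, add_zero]
  exact hf0 (HahnSeries.coeff_order_eq_zero.1 h4)

lemma OO_ratio {k : ℤ} (hk : 0 < k) {v w : HahnSeries Γ2 F} (hv : OO k v) (hw : OO k w) :
    OO k ((1 - v) / (1 - w) - 1) := by
  have hne := one_sub_ne hk hw
  have : (1 - v) / (1 - w) - 1 = (w - v) * (1 - w)⁻¹ := by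
    field_simp; ring
  rw [this]
  simpa using (hw.sub hv).mul (OO_inv hk hw)

lemma OO_mul1 {k : ℤ} (hk : 0 < k) {v w : HahnSeries Γ2 F} (hv : OO k (v - 1)) (hw : OO k (w - 1)) :
    OO k (v * w - 1) := by
  have : v * w - 1 = (v - 1) * (w - 1) + ((v - 1) + (w - 1)) := by ring
  rw [this]
  exact ((hv.mul hw).le (by omega)).add (hv.add hw)

lemma OO_prod1 {ι : Type*} {k : ℤ} (hk : 0 < k) (S : Finset ι) (v : ι → HahnSeries Γ2 F)
    (hv : ∀ s ∈ S, OO k (v s - 1)) : OO k (∏ s ∈ S, v s - 1) := by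
  classical
  induction S using Finset.induction_on with
  | empty => intro g _; simp
  | insert a S ha ih =>
    rw [Finset.prod_insert ha]
    exact OO_mul1 hk (hv a (by simp)) (ih fun s hs => hv s (by simp [hs]))

/-- The factor attached to a weight. -/
def phi (c y : F) (w : ℤ × ℤ) : HahnSeries Γ2 F :=
  (1 - HahnSeries.single (toLex (w.2 - w.1, -w.1)) (y⁻¹ * c)) /
    (1 - HahnSeries.single (toLex (w.2 - w.1, -w.1)) c)

lemma OO_phi_inv (c y : F) (w : ℤ × ℤ) {k : ℤ} (hk : 0 < k) (h : k ≤ w.2 - w.1) :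
    OO k ((phi c y w)⁻¹ - 1) := by
  rw [phi, inv_div]
  exact OO_ratio hk ((OO_single _ _ _).le h) ((OO_single _ _ _).le h)

lemma one_sub_single_ne (w : ℤ × ℤ) (hw : w ≠ 0) (c : F) :
    1 - HahnSeries.single (toLex (w.2 - w.1, -w.1) : Γ2) c ≠ 0 := by
  intro h
  have h0 : (0 : Γ2) ≠ toLex (w.2 - w.1, -w.1) := by
    intro h0
    apply hw
    have h1 : (0 : ℤ) = w.2 - w.1 := congrArg (fun g : Γ2 => (ofLex g).1) h0
    have h2 : (0 : ℤ) = - w.1 := congrArg (fun g : Γ2 => (ofLex g).2) h0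
    ext
    · simp; omega
    · simp; omega
  have := congrArg (fun f : HahnSeries Γ2 F => f.coeff 0) h
  simp [HahnSeries.coeff_single_of_ne h0] at this

lemma phi_ne (c y : F) (w : ℤ × ℤ) (hw : w ≠ 0) : phi c y w ≠ 0 :=
  div_ne_zero (one_sub_single_ne w hw _) (one_sub_single_ne w hw _)

lemma phi_dual (c y : F) (hc : c ≠ 0) (hy : y ≠ 0) (w : ℤ × ℤ) :
    phi c⁻¹ y⁻¹ w = HahnSeries.C y * phi c y (-w) := by
  have hs : ∀ d : F, HahnSeries.single (toLex (w.2 - w.1, -w.1) : Γ2) c⁻¹ *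
      HahnSeries.single (toLex ((-w).2 - (-w).1, -(-w).1) : Γ2) (d * c) = HahnSeries.C d := by
    intro d
    rw [HahnSeries.single_mul_single, HahnSeries.C_apply]
    congr 1
    · rw [← toLex_add]
      simp only [Prod.snd_neg, Prod.fst_neg, Prod.mk_add_mk]
      have : ((w.2 - w.1 + (-w.2 - -w.1), -w.1 + - -w.1) : ℤ × ℤ) = 0 := by
        ext <;> simp
      rw [this]; rfl
    · field_simp
  have h1 := hs 1
  have h2 := hs y⁻¹
  have h3 : HahnSeries.single (toLex (w.2 - w.1, -w.1) : Γ2) (y⁻¹⁻¹ * c⁻¹) =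
      HahnSeries.C y * HahnSeries.single (toLex (w.2 - w.1, -w.1) : Γ2) c⁻¹ := by
    rw [HahnSeries.C_apply, HahnSeries.single_mul_single]; simp
  have h4 : (HahnSeries.C y : HahnSeries Γ2 F) * HahnSeries.C y⁻¹ = 1 := by
    rw [← map_mul, mul_inv_cancel₀ hy, map_one]
  rw [phi, phi, h3]
  rw [one_mul, map_one] at h1
  have hne : HahnSeries.single (toLex (w.2 - w.1, -w.1) : Γ2) c⁻¹ ≠ 0 := left_ne_zero_of_mul_eq_one h1
  generalize HahnSeries.single (toLex (w.2 - w.1, -w.1) : Γ2) c⁻¹ = s at *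
  symm
  rw [← mul_div_assoc, ← mul_div_mul_left _ _ (neg_ne_zero.2 hne)]
  congr 1
  · linear_combination (HahnSeries.C y) * h2 + h4
  · linear_combination h1

end hahn
section final
variable {F}

lemma phi_congr (d1 d2 : HahnSeries Γ2 F) (c y : F) (w : ℤ × ℤ)
    (h1 : d1 = HahnSeries.single (toLex (w.2 - w.1, -w.1)) (y⁻¹ * c))
    (h2 : d2 = HahnSeries.single (toLex (w.2 - w.1, -w.1)) c) :
    (1 - d1) / (1 - d2) = phi c y w := by
  rw [h1, h2, phi]

lemma C_mul_mono (c : F) (a b : ℤ) :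
    HahnSeries.C c * mono F a b = HahnSeries.single (toLex (b - a, -a)) c := by
  rw [mono, HahnSeries.C_apply, HahnSeries.single_mul_single]; simp

lemma mono_mul (a b a' b' : ℤ) : mono F a b * mono F a' b' = mono F (a + a') (b + b') := by
  rw [mono, mono, mono, HahnSeries.single_mul_single, ← toLex_add, Prod.mk_add_mk, one_mul]
  have h1 : b - a + (b' - a') = b + b' - (a + a') := by ring
  have h2 : -a + -a' = -(a + a') := by ring
  rw [h1, h2]

lemma C_inv (c : F) : (HahnSeries.C c : HahnSeries Γ2 F)⁻¹ = HahnSeries.C c⁻¹ :=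
  (map_inv₀ _ _).symm

lemma Mratio (K1 K2 : HahnSeries Γ2 F) (c y : F) (a b : ℤ) (N : ℕ)
    (h1 : K1 = HahnSeries.C (y⁻¹ * c) * mono F a b) (h2 : K2 = HahnSeries.C c * mono F a b) :
    Mtr F K1 N / Mtr F K2 N =
      (∏ s ∈ Finset.range N ×ˢ Finset.range N,
        phi c y (a - ((s.2 : ℤ) + 1), b + ((s.1 : ℤ) + 1)))⁻¹ := by
  rw [Mtr, Mtr, Finset.prod_product_right, ← Finset.prod_div_distrib, ← Finset.prod_inv_distrib]
  refine Finset.prod_congr rfl fun n _ => ?_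
  rw [← Finset.prod_div_distrib, ← Finset.prod_inv_distrib]
  refine Finset.prod_congr rfl fun m _ => ?_
  rw [h1, h2, mul_assoc, mul_assoc, mono_mul, C_mul_mono, C_mul_mono, phi, inv_div, inv_div_inv]
  rfl

lemma dual_side (c y : F) (hc : c ≠ 0) (hy : y ≠ 0) {ι κ : Type*} (S : Finset ι)
    (P Q : ι → ℤ × ℤ) (S1 S2 : Finset κ) (L1 L2 : κ → ℤ × ℤ) (K : HahnSeries Γ2 F)
    (h : (∏ s ∈ S, phi c y (-P s)) / ∏ s ∈ S, phi c y (-Q s) =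
      K * ((∏ s ∈ S1, (phi c y (-L1 s))⁻¹) * ∏ s ∈ S2, (phi c y (-L2 s))⁻¹)) :
    HahnSeries.C y ^ (-(S2.card : ℤ) - (S1.card : ℤ)) * (∏ s ∈ S, phi c⁻¹ y⁻¹ (Q s))⁻¹ *
      ∏ s ∈ S, phi c⁻¹ y⁻¹ (P s) =
    K * ((∏ s ∈ S1, (phi c⁻¹ y⁻¹ (L1 s))⁻¹) * ∏ s ∈ S2, (phi c⁻¹ y⁻¹ (L2 s))⁻¹) := by
  have hC : (HahnSeries.C y : HahnSeries Γ2 F) ≠ 0 := by simpa using hy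
  simp only [phi_dual c y hc hy, mul_inv, Finset.prod_mul_distrib, Finset.prod_const]
  set Y : HahnSeries Γ2 F := HahnSeries.C y
  have e : Y ^ (-(S2.card : ℤ) - (S1.card : ℤ)) = Y⁻¹ ^ S1.card * Y⁻¹ ^ S2.card := by
    rw [sub_eq_add_neg, zpow_add₀ hC, zpow_neg, zpow_neg, zpow_natCast, zpow_natCast, inv_pow,
      inv_pow, mul_comm]
  rw [e]
  have hp : (Y ^ S.card)⁻¹ * Y ^ S.card = 1 := inv_mul_cancel₀ (pow_ne_zero _ hC)
  rw [div_eq_mul_inv] at h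
  linear_combination (Y⁻¹ ^ S1.card * Y⁻¹ ^ S2.card) * h + (Y⁻¹ ^ S1.card * Y⁻¹ ^ S2.card *
    (∏ s ∈ S, phi c y (-Q s))⁻¹ * (∏ s ∈ S, phi c y (-P s))) * hp

end final

/-- `[M(y⁻¹ e_i e_j⁻¹ t₁; t₁⁻¹, t₂) / M(e_i e_j⁻¹ t₁; t₁⁻¹, t₂)]
      · ∏_{n,m>0} (1 − y⁻¹ t₁ u_{j,n} v_{i,m}) / (1 − t₁ u_{j,n} v_{i,m})
    = y^{−|γ_i|−|γ_j|} · [M(y e_j e_i⁻¹ t₂⁻¹; t₁⁻¹, t₂) / M(e_j e_i⁻¹ t₂⁻¹; t₁⁻¹, t₂)]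
      · ∏_{n,m>0} (1 − y t₂⁻¹ u_{i,n} v_{j,m}) / (1 − t₂⁻¹ u_{i,n} v_{j,m})`,
as an identity of formal series (coefficientwise limits of the truncations). -/
theorem statement4 (r : ℕ) (hr : 1 ≤ r) (Pa : Fin r → YoungDiagram)
    (e : Fin r → F) (he : ∀ i, e i ≠ 0) (y : F) (hy : y ≠ 0) (i j : Fin r) :
    ∀ bound : Γ2, ∃ N₀ : ℕ, ∀ N ≥ N₀, ∀ g : Γ2, g ≤ bound →
      ((Mtr F ((HahnSeries.C y)⁻¹ * HahnSeries.C (e i) * (HahnSeries.C (e j))⁻¹ *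
            mono F 1 0) N /
          Mtr F (HahnSeries.C (e i) * (HahnSeries.C (e j))⁻¹ * mono F 1 0) N) *
        ∏ n ∈ Finset.range N, ∏ m ∈ Finset.range N,
          (1 - (HahnSeries.C y)⁻¹ * mono F 1 0 * uMon F Pa e j n * vMon F Pa e i m) /
          (1 - mono F 1 0 * uMon F Pa e j n * vMon F Pa e i m)).coeff g
      = ((HahnSeries.C y ^ (-((Pa i).cells.card : ℤ) - ((Pa j).cells.card : ℤ))) *
        (Mtr F (HahnSeries.C y * HahnSeries.C (e j) * (HahnSeries.C (e i))⁻¹ *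
            mono F 0 (-1)) N /
          Mtr F (HahnSeries.C (e j) * (HahnSeries.C (e i))⁻¹ * mono F 0 (-1)) N) *
        ∏ n ∈ Finset.range N, ∏ m ∈ Finset.range N,
          (1 - HahnSeries.C y * mono F 0 (-1) * uMon F Pa e i n * vMon F Pa e j m) /
          (1 - mono F 0 (-1) * uMon F Pa e i n * vMon F Pa e j m)).coeff g := by
  intro bound
  set μ := Pa j with hμd
  set ν := Pa i with hνd
  set c : F := e i * (e j)⁻¹ with hcd
  have hc : c ≠ 0 := mul_ne_zero (he i) (inv_ne_zero (he j))
  have hcinv : c⁻¹ = e j * (e i)⁻¹ := by rw [hcd, mul_inv, inv_inv, mul_comm]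
  set K : HahnSeries Γ2 F := del (phi c y) ^ ((TT μ ν).coeff 0).toNat * PV (phi c y) (TT μ ν)
  obtain ⟨B, hB⟩ : ∃ B : ℕ, ∀ d ∈ μ.cells ∪ ν.cells, d.1 < B ∧ d.2 < B := by
    refine ⟨(μ.cells ∪ ν.cells).sup (fun d => d.1 + d.2) + 1, fun d hd => ?_⟩
    have := Finset.le_sup (f := fun d : ℕ × ℕ => d.1 + d.2) hd
    change d.1 + d.2 ≤ _ at this
    omega
  refine ⟨2 * B + 2 + ((ofLex bound).1 - (ofLex K.order).1).toNat, fun N hN g hg => ?_⟩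
  have hμ : ∀ d ∈ μ.cells, d.1 < B ∧ d.2 < B := fun d hd => hB d (Finset.mem_union_left _ hd)
  have hν : ∀ d ∈ ν.cells, d.1 < B ∧ d.2 < B := fun d hd => hB d (Finset.mem_union_right _ hd)
  have hμN : ∀ d ∈ μ.cells, d.1 < N ∧ d.2 < N := fun d hd => by have := hμ d hd; omega
  have hνN : ∀ d ∈ ν.cells, d.1 < N ∧ d.2 < N := fun d hd => by have := hν d hd; omega
  set R := Finset.range N ×ˢ Finset.range N
  -- left side
  have hL := keyf (phi c y) (phi_ne c y) R
    (fun s => (1 + (μ.colLen s.1 : ℤ) - ((s.2 : ℤ) + 1), (s.1 : ℤ) + 1 - ν.rowLen s.2))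
    (fun s => (1 - ((s.2 : ℤ) + 1), 0 + ((s.1 : ℤ) + 1)))
    ν.cells μ.cells (fun d => (-(d.1 : ℤ), (N : ℤ) - d.2))
    (fun d => (1 - (N : ℤ) + d.1, 1 + (d.2 : ℤ))) (TT μ ν)
    (by intro s _ h; have := congrArg Prod.snd h; simp at this; omega)
    (by intro d hd h; have := congrArg Prod.snd h; have := hνN d hd; simp at *; omega)
    (by intro d hd h; have := congrArg Prod.snd h; simp at this; omega)
    (by
      have := lemA μ ν N hμN hνN
      simp only [R, Finset.sum_product, zero_add]
      exact this)
  have hR0 := keyf (phi c y) (phi_ne c y) R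
    (fun s => -(0 + (ν.colLen s.1 : ℤ) - ((s.2 : ℤ) + 1), -1 + ((s.1 : ℤ) + 1) - μ.rowLen s.2))
    (fun s => -(0 - ((s.2 : ℤ) + 1), -1 + ((s.1 : ℤ) + 1)))
    μ.cells ν.cells (fun d => -(-1 - (d.1 : ℤ), (N : ℤ) - 1 - d.2))
    (fun d => -((d.1 : ℤ) - N, (d.2 : ℤ))) (TT μ ν)
    (by intro s _ h; have := congrArg Prod.fst h; simp at this; omega)
    (by intro d hd h; have := congrArg Prod.fst h; simp at this; omega)
    (by intro d hd h; have := congrArg Prod.fst h; have := hνN d hd; simp at *; omega)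
    (by
      have := lemB μ ν N hμN hνN
      simp only [R, Finset.sum_product, Prod.fst_neg, Prod.snd_neg]
      convert this using 3
      · refine Finset.sum_congr rfl fun m _ => ?_
        congr 1 <;> ring
      · refine Finset.sum_congr rfl fun m _ => ?_
        congr 1 <;> ring
      · refine Finset.sum_congr rfl fun m _ => ?_
        congr 1 <;> ring
      · refine Finset.sum_congr rfl fun m _ => ?_
        congr 1; ring)
  have hR := dual_side c y hc hy R _ _ μ.cells ν.cells _ _ K hR0
  have eL : ∏ n ∈ Finset.range N, ∏ m ∈ Finset.range N,
          (1 - (HahnSeries.C y)⁻¹ * mono F 1 0 * uMon F Pa e j n * vMon F Pa e i m) /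
          (1 - mono F 1 0 * uMon F Pa e j n * vMon F Pa e i m) =
      ∏ s ∈ R, phi c y (1 + (μ.colLen s.1 : ℤ) - ((s.2 : ℤ) + 1), (s.1 : ℤ) + 1 - ν.rowLen s.2) := by
    rw [Finset.prod_product]
    refine Finset.prod_congr rfl fun n _ => Finset.prod_congr rfl fun m _ => ?_
    have h : mono F 1 0 * mono F (μ.colLen n) (n + 1) * mono F (-(m + 1)) (-ν.rowLen m) =
        mono F (1 + (μ.colLen n : ℤ) - ((m : ℤ) + 1)) ((n : ℤ) + 1 - ν.rowLen m) := by
      rw [mono_mul, mono_mul]; congr 1; ring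
    refine phi_congr _ _ _ _ _ ?_ ?_
    · rw [← C_mul_mono, ← h, hcd, uMon, vMon, C_inv, C_inv, map_mul, map_mul]; ring
    · rw [← C_mul_mono, ← h, hcd, uMon, vMon, C_inv, map_mul]; ring
  have eR : ∏ n ∈ Finset.range N, ∏ m ∈ Finset.range N,
          (1 - HahnSeries.C y * mono F 0 (-1) * uMon F Pa e i n * vMon F Pa e j m) /
          (1 - mono F 0 (-1) * uMon F Pa e i n * vMon F Pa e j m) =
      ∏ s ∈ R, phi c⁻¹ y⁻¹
        (0 + (ν.colLen s.1 : ℤ) - ((s.2 : ℤ) + 1), -1 + ((s.1 : ℤ) + 1) - μ.rowLen s.2) := by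
    rw [Finset.prod_product]
    refine Finset.prod_congr rfl fun n _ => Finset.prod_congr rfl fun m _ => ?_
    have h : mono F 0 (-1) * mono F (ν.colLen n) (n + 1) * mono F (-(m + 1)) (-μ.rowLen m) =
        mono F (0 + (ν.colLen n : ℤ) - ((m : ℤ) + 1)) (-1 + ((n : ℤ) + 1) - μ.rowLen m) := by
      rw [mono_mul, mono_mul]; congr 1
    refine phi_congr _ _ _ _ _ ?_ ?_
    · rw [← C_mul_mono, ← h, hcinv, inv_inv, uMon, vMon, C_inv, map_mul, map_mul]; ring
    · rw [← C_mul_mono, ← h, hcinv, uMon, vMon, C_inv, map_mul]; ring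
  rw [eL, eR, Mratio _ _ c y 1 0 N (by rw [hcd, C_inv, C_inv, map_mul, map_mul]; ring)
      (by rw [hcd, C_inv, map_mul]),
    Mratio _ _ c⁻¹ y⁻¹ 0 (-1) N (by rw [hcinv, inv_inv, C_inv, map_mul, map_mul]; ring)
      (by rw [hcinv, C_inv, map_mul]), hR]
  rw [mul_comm, ← div_eq_mul_inv, hL]
  set k : ℤ := N - 2 * B with hk
  have hk0 : 0 < k := by omega
  have hE1 : OO k ((∏ d ∈ ν.cells, (phi c y (-(d.1 : ℤ), (N : ℤ) - d.2))⁻¹) *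
      (∏ d ∈ μ.cells, (phi c y (1 - (N : ℤ) + d.1, 1 + (d.2 : ℤ)))⁻¹) - 1) := by
    refine OO_mul1 hk0 (OO_prod1 hk0 _ _ fun d hd => OO_phi_inv _ _ _ hk0 ?_)
      (OO_prod1 hk0 _ _ fun d hd => OO_phi_inv _ _ _ hk0 ?_)
    · have := hν d hd; simp only; omega
    · have := hμ d hd; simp only; omega
  have hE2 : OO k ((∏ d ∈ μ.cells, (phi c⁻¹ y⁻¹ (-1 - (d.1 : ℤ), (N : ℤ) - 1 - d.2))⁻¹) *
      (∏ d ∈ ν.cells, (phi c⁻¹ y⁻¹ ((d.1 : ℤ) - N, (d.2 : ℤ)))⁻¹) - 1) := by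
    refine OO_mul1 hk0 (OO_prod1 hk0 _ _ fun d hd => OO_phi_inv _ _ _ hk0 ?_)
      (OO_prod1 hk0 _ _ fun d hd => OO_phi_inv _ _ _ hk0 ?_)
    · have := hμ d hd; simp only; omega
    · have := hν d hd; simp only; omega
  have hfin := (OO_order K).mul (hE1.sub hE2)
  rw [sub_sub_sub_cancel_right, mul_sub] at hfin
  have hg1 : (ofLex g).1 ≤ (ofLex bound).1 := by
    rcases Prod.Lex.le_iff.1 hg with h | h
    · exact h.le
    · exact h.1.le
  have := hfin g (by omega)
  rw [HahnSeries.coeff_sub, sub_eq_zero] at this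
  exact this

end
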